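/- arXiv:0903.4848 — 2 statements merged into one kernel-verified Lean document; each statement's English description precedes it below -/
import Mathlib

section
/- For every integer k, the family { π^{-1/2} · ψ_{k,n} : n ∈ ℤ } is a Hilbert (complete orthonormal) basis of L²_{(k)}(ℝ). -/
open MeasureTheory

/-- The wavepacket basis function `ψ_{k,n}(x) = (x+i)^{-(k+1)} ((x-i)/(x+i))^n`. -/
noncomputable def psi (k n : ℤ) : ℝ → ℂ := fun x =>
  ((x : ℂ) + Complex.I) ^ (-(k + 1)) * (((x : ℂ) - Complex.I) / ((x : ℂ) + Complex.I)) ^ n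

/-- The weighted measure `(x² + 1)^k dx` on `ℝ`, whose `L²` space is `L²_{(k)}(ℝ)`. -/
noncomputable def wMeasure (k : ℤ) : Measure ℝ :=
  volume.withDensity fun x => ENNReal.ofReal ((x ^ 2 + 1) ^ k)

open scoped ComplexConjugate

namespace CayleyBasis

lemma ofReal_add_I_ne_zero (x : ℝ) : (x : ℂ) + Complex.I ≠ 0 := fun h => by
  simpa using congrArg Complex.im h

lemma ofReal_sub_I_ne_zero (x : ℝ) : (x : ℂ) - Complex.I ≠ 0 := fun h => by
  simpa using congrArg Complex.im h

lemma ofReal_add_I_mul_sub_I (x : ℝ) :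
    ((x : ℂ) + Complex.I) * ((x : ℂ) - Complex.I) = ((x ^ 2 + 1 : ℝ) : ℂ) := by
  push_cast
  linear_combination -Complex.I_sq

lemma norm_ofReal_add_I_zpow_sq (j : ℤ) (x : ℝ) :
    (‖(x : ℂ) + Complex.I‖ ^ j) ^ 2 = (x ^ 2 + 1) ^ j := by
  rw [← zpow_natCast, zpow_comm, zpow_natCast, Complex.sq_norm, Complex.normSq_apply]
  simp [sq]

/-- The Cayley transform `x ↦ (x - i) / (x + i)`. -/
noncomputable def cayley (x : ℝ) : ℂ := ((x : ℂ) - Complex.I) / ((x : ℂ) + Complex.I)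

lemma cayley_ne_zero (x : ℝ) : cayley x ≠ 0 :=
  div_ne_zero (ofReal_sub_I_ne_zero x) (ofReal_add_I_ne_zero x)

lemma conj_cayley (x : ℝ) : conj (cayley x) = (cayley x)⁻¹ := by
  simp [cayley, sub_eq_add_neg]

lemma norm_cayley (x : ℝ) : ‖cayley x‖ = 1 := by
  have h := Complex.mul_conj' (cayley x)
  rw [conj_cayley, mul_inv_cancel₀ (cayley_ne_zero x)] at h
  have h2 : ‖cayley x‖ ^ 2 = 1 := by exact_mod_cast h.symm
  exact (pow_eq_one_iff_of_nonneg (norm_nonneg _) two_ne_zero).1 h2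

lemma psi_eq (k n : ℤ) (x : ℝ) :
    psi k n x = ((x : ℂ) + Complex.I) ^ (-(k + 1)) * cayley x ^ n := rfl

lemma psi_mul_zpow (k n : ℤ) (x : ℝ) :
    psi k n x * ((x : ℂ) + Complex.I) ^ (k + 1) = cayley x ^ n := by
  rw [psi_eq, mul_right_comm, ← zpow_add₀ (ofReal_add_I_ne_zero x)]
  simp

lemma continuous_psi (k n : ℤ) : Continuous (psi k n) := by
  have h : Continuous fun x : ℝ => (x : ℂ) + Complex.I := by fun_prop
  have h' : Continuous fun x : ℝ => (x : ℂ) - Complex.I := by fun_prop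
  exact (h.zpow₀ _ fun x => Or.inl (ofReal_add_I_ne_zero x)).mul
    ((h'.div h ofReal_add_I_ne_zero).zpow₀ _ fun x => Or.inl (cayley_ne_zero x))

/-- The weight of `L²_{(k)}` cancels against the denominator of `ψ_{k,n}`, up to a factor
independent of `k`. -/
lemma weight_smul_conj_psi_mul (k n : ℤ) (x : ℝ) (z : ℂ) :
    ((x ^ 2 + 1) ^ k : ℝ) • (conj (psi k n x) * z) =
      ((x ^ 2 + 1) ^ (-1 : ℤ) : ℝ) •
        (cayley x ^ (-n) * (((x : ℂ) + Complex.I) ^ (k + 1) * z)) := by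
  have ha := ofReal_add_I_ne_zero x
  have hb := ofReal_sub_I_ne_zero x
  have hconj : conj ((x : ℂ) + Complex.I) = (x : ℂ) - Complex.I := by simp [sub_eq_add_neg]
  rw [psi_eq, map_mul, map_zpow₀, map_zpow₀, conj_cayley, hconj, Complex.real_smul,
    Complex.real_smul, Complex.ofReal_zpow, Complex.ofReal_zpow, ← ofReal_add_I_mul_sub_I,
    mul_zpow, mul_zpow, inv_zpow, ← zpow_neg (cayley x)]
  simp only [neg_add, zpow_add₀ ha, zpow_add₀ hb, zpow_neg, zpow_one]
  field_simp

lemma measurable_weight (k : ℤ) : Measurable fun x : ℝ => ENNReal.ofReal ((x ^ 2 + 1) ^ k) := by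
  have h : Continuous fun x : ℝ => (x ^ 2 + 1) ^ k :=
    Continuous.zpow₀ (by fun_prop) _ fun x => Or.inl (by positivity)
  exact h.measurable.ennreal_ofReal

lemma ae_wMeasure (k : ℤ) : ae (wMeasure k) = ae volume := by
  refine le_antisymm (withDensity_absolutelyContinuous _ _).ae_le
    (withDensity_absolutelyContinuous' (measurable_weight k).aemeasurable ?_).ae_le
  refine ae_of_all _ fun x => ?_
  simpa using (by positivity : 0 < (x ^ 2 + 1) ^ k)

lemma toReal_weight (k : ℤ) (x : ℝ) :
    (ENNReal.ofReal ((x ^ 2 + 1) ^ k)).toReal = (x ^ 2 + 1) ^ k :=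
  ENNReal.toReal_ofReal (by positivity)

lemma integral_wMeasure (k : ℤ) (f : ℝ → ℂ) :
    ∫ x, f x ∂wMeasure k = ∫ x, ((x ^ 2 + 1) ^ k : ℝ) • f x := by
  rw [wMeasure, integral_withDensity_eq_integral_toReal_smul (measurable_weight k)
    (ae_of_all _ fun _ => ENNReal.ofReal_lt_top)]
  simp only [toReal_weight]

lemma integrable_wMeasure_iff (k : ℤ) (f : ℝ → ℝ) :
    Integrable f (wMeasure k) ↔ Integrable fun x => ((x ^ 2 + 1) ^ k : ℝ) * f x := by
  rw [wMeasure, integrable_withDensity_iff_integrable_smul' (measurable_weight k)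
    (ae_of_all _ fun _ => ENNReal.ofReal_lt_top)]
  simp only [toReal_weight, smul_eq_mul]

lemma aestronglyMeasurable_wMeasure_iff (j k : ℤ) {f : ℝ → ℂ} :
    AEStronglyMeasurable f (wMeasure j) ↔ AEStronglyMeasurable f (wMeasure k) :=
  ⟨fun h => h.mono_ac (Measure.ae_le_iff_absolutelyContinuous.1 (by simp [ae_wMeasure])),
    fun h => h.mono_ac (Measure.ae_le_iff_absolutelyContinuous.1 (by simp [ae_wMeasure]))⟩

lemma memLp_psi (k n : ℤ) : MemLp (psi k n) 2 (wMeasure k) := by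
  rw [memLp_two_iff_integrable_sq_norm (continuous_psi k n).aestronglyMeasurable,
    integrable_wMeasure_iff]
  refine integrable_inv_one_add_sq.congr (ae_of_all _ fun x => ?_)
  have h : (x ^ 2 + 1 : ℝ) ≠ 0 := by positivity
  simp only [psi_eq, norm_mul, norm_ofReal_add_I_zpow_sq, norm_zpow, norm_cayley, one_zpow,
    mul_one, ← zpow_add₀ h]
  simp [add_comm]

lemma memLp_zpow_mul {k : ℤ} {f : ℝ → ℂ} (hf : MemLp f 2 (wMeasure k)) :
    MemLp (fun x : ℝ => ((x : ℂ) + Complex.I) ^ (k + 1) * f x) 2 (wMeasure (-1)) := by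
  have hc : Continuous fun x : ℝ => ((x : ℂ) + Complex.I) ^ (k + 1) :=
    Continuous.zpow₀ (by fun_prop) _ fun x => Or.inl (ofReal_add_I_ne_zero x)
  have hm := (aestronglyMeasurable_wMeasure_iff k (-1)).1 hf.1
  refine (memLp_two_iff_integrable_sq_norm (hc.aestronglyMeasurable.mul hm)).2 ?_
  rw [integrable_wMeasure_iff]
  have hi := (memLp_two_iff_integrable_sq_norm hf.1).1 hf
  rw [integrable_wMeasure_iff] at hi
  refine hi.congr (ae_of_all _ fun x => ?_)
  have h : (x ^ 2 + 1 : ℝ) ≠ 0 := by positivity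
  simp only [Pi.mul_apply, norm_mul, norm_zpow, mul_pow, norm_ofReal_add_I_zpow_sq, ← mul_assoc,
    ← zpow_add₀ h]
  simp

instance fact_pi_pos : Fact (0 < Real.pi) := ⟨Real.pi_pos⟩

/-- The angle `arctan x`, as a point of the circle `ℝ / πℤ`. -/
noncomputable def angle (x : ℝ) : AddCircle Real.pi := (Real.arctan x : AddCircle Real.pi)

lemma measurableEmbedding_angle : MeasurableEmbedding angle := by
  refine Continuous.measurableEmbedding
    ((AddCircle.continuous_mk' _).comp Real.continuous_arctan) fun x y hxy => ?_
  have hmem (z : ℝ) : Real.arctan z ∈ Set.Ioc (-(Real.pi / 2)) (-(Real.pi / 2) + Real.pi) :=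
    ⟨Real.neg_pi_div_two_lt_arctan z, by linarith [Real.arctan_lt_pi_div_two z]⟩
  exact Real.arctan_injective ((AddCircle.coe_eq_coe_iff_of_mem_Ioc (hmem x) (hmem y)).1 hxy)

lemma measurePreserving_arctan : MeasurePreserving Real.arctan (wMeasure (-1))
    (volume.restrict (Set.Ioc (-(Real.pi / 2)) (-(Real.pi / 2) + Real.pi))) := by
  refine ⟨Real.continuous_arctan.measurable, ?_⟩
  have h := map_withDensity_abs_det_fderiv_eq_addHaar (μ := volume) (s := Set.univ)
    MeasurableSet.univ.nullMeasurableSet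
    (fun x _ => (Real.hasDerivAt_arctan x).hasFDerivAt.hasFDerivWithinAt)
    Real.arctan_injective.injOn
  rw [Set.image_univ, Real.range_arctan, Measure.restrict_univ] at h
  rw [show -(Real.pi / 2) + Real.pi = Real.pi / 2 by ring, ← restrict_Ioo_eq_restrict_Ioc, ← h,
    wMeasure]
  congr 2
  ext x
  rw [ContinuousLinearMap.det_toSpanSingleton, abs_of_pos (by positivity)]
  simp [add_comm]

lemma measurePreserving_angle : MeasurePreserving angle (wMeasure (-1)) volume :=
  (AddCircle.measurePreserving_mk Real.pi (-(Real.pi / 2))).comp measurePreserving_arctan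

lemma fourier_one_angle (x : ℝ) : fourier 1 (angle x) = -cayley x := by
  have hs : (Real.sqrt (1 + x ^ 2) : ℂ) ≠ 0 := by
    exact_mod_cast (Real.sqrt_pos.2 (by positivity : 0 < 1 + x ^ 2)).ne'
  have hs2 : (Real.sqrt (1 + x ^ 2) : ℂ) ^ 2 = 1 + (x : ℂ) ^ 2 := by
    exact_mod_cast Real.sq_sqrt (by positivity : 0 ≤ 1 + x ^ 2)
  have ha := ofReal_add_I_ne_zero x
  have hpi : (Real.pi : ℂ) ≠ 0 := by exact_mod_cast Real.pi_ne_zero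
  have he : Complex.exp (Real.arctan x * Complex.I) =
      (1 + x * Complex.I) / Real.sqrt (1 + x ^ 2) := by
    rw [Complex.exp_mul_I, ← Complex.ofReal_cos, ← Complex.ofReal_sin, Real.cos_arctan,
      Real.sin_arctan]
    push_cast
    ring
  rw [angle, fourier_coe_apply]
  rw [show 2 * Real.pi * Complex.I * (1 : ℤ) * Real.arctan x / Real.pi =
      (2 : ℕ) * (Real.arctan x * Complex.I) by push_cast; field_simp, Complex.exp_nat_mul, he,
    div_pow, hs2, cayley, ← neg_div, div_eq_div_iff (hs2 ▸ pow_ne_zero 2 hs) ha]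
  linear_combination (2 * (x : ℂ) + (x : ℂ) ^ 2 * Complex.I + (x : ℂ) ^ 3) * Complex.I_sq

lemma fourier_angle (n : ℤ) (x : ℝ) : fourier n (angle x) = (-cayley x) ^ n := by
  rw [← fourier_one_angle]
  simp only [fourier_apply, one_zsmul, AddCircle.toCircle_zsmul, Circle.coe_zpow]

lemma cayley_zpow (n : ℤ) (x : ℝ) : cayley x ^ n = (-1) ^ n * fourier n (angle x) := by
  rw [fourier_angle, ← mul_zpow]
  simp

lemma integral_cayley_zpow_wMeasure (n : ℤ) :
    ∫ x, cayley x ^ n ∂wMeasure (-1) = if n = 0 then (Real.pi : ℂ) else 0 := by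
  simp only [cayley_zpow, integral_const_mul]
  rw [measurePreserving_angle.integral_comp measurableEmbedding_angle (fun t => fourier n t)]
  have h := fourierCoeff_fourier (T := Real.pi) n
  have h0 := congrFun h 0
  simp only [fourierCoeff, neg_zero, fourier_zero, one_smul] at h0
  rw [AddCircle.integral_haarAddCircle] at h0
  have hpi : (Real.pi : ℂ) ≠ 0 := by exact_mod_cast Real.pi_ne_zero
  split_ifs with hn
  · subst hn
    rw [Pi.single_eq_same, Complex.real_smul, Complex.ofReal_inv] at h0
    rw [zpow_zero, one_mul, ← mul_one (Real.pi : ℂ), ← h0, mul_inv_cancel_left₀ hpi]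
  · rw [Pi.single_eq_of_ne (Ne.symm hn), smul_eq_zero] at h0
    rw [h0.resolve_left (inv_ne_zero Real.pi_ne_zero), mul_zero]

/-- A function in `L²` of the Cauchy weight that is orthogonal to all powers of the Cayley
transform vanishes. -/
lemma ae_eq_zero_of_integral_cayley_zpow_mul {h : ℝ → ℂ} (hh : MemLp h 2 (wMeasure (-1)))
    (h0 : ∀ n : ℤ, ∫ x, cayley x ^ n * h x ∂wMeasure (-1) = 0) :
    h =ᵐ[wMeasure (-1)] 0 := by
  have hcomp : Function.extend angle h 0 ∘ angle = h :=
    funext fun x => measurableEmbedding_angle.injective.extend_apply _ _ x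
  have hH : MemLp (Function.extend angle h 0) 2 (volume : Measure (AddCircle Real.pi)) := by
    rw [← measurePreserving_angle.map_eq, measurableEmbedding_angle.memLp_map_measure_iff, hcomp]
    exact hh
  have hH' := hH.haarAddCircle
  have hz : hH'.toLp _ = 0 := by
    refine fourierBasis.repr.map_eq_zero_iff.1 (lp.ext (funext fun n => ?_))
    rw [fourierBasis_repr, fourierCoeff_congr_ae hH'.coeFn_toLp, fourierCoeff,
      AddCircle.integral_haarAddCircle, ← measurePreserving_angle.integral_comp
      measurableEmbedding_angle]
    have h1 := h0 (-n)
    simp only [cayley_zpow, mul_assoc, integral_const_mul] at h1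
    have h2 := (mul_eq_zero.1 h1).resolve_left (zpow_ne_zero _ (by norm_num))
    simp only [measurableEmbedding_angle.injective.extend_apply, smul_eq_mul, h2]
    simp
  have hae : Function.extend angle h 0 =ᵐ[(volume : Measure (AddCircle Real.pi))] 0 := by
    rw [AddCircle.volume_eq_smul_haarAddCircle]
    exact Measure.ae_smul_measure ((Lp.eq_zero_iff_ae_eq_zero.1 hz) |> hH'.coeFn_toLp.symm.trans) _
  have := measurePreserving_angle.quasiMeasurePreserving.ae_eq_comp hae
  rw [hcomp] at this
  exact this

/-- The function `π^{-1/2} ψ_{k,n}` as an element of `L²_{(k)}`. -/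
noncomputable def psiLp (k n : ℤ) : Lp ℂ 2 (wMeasure k) :=
  ((memLp_psi k n).const_mul (((Real.sqrt Real.pi)⁻¹ : ℝ) : ℂ)).toLp _

lemma coeFn_psiLp (k n : ℤ) : (psiLp k n : ℝ → ℂ) =ᵐ[wMeasure k]
    fun x => (((Real.sqrt Real.pi)⁻¹ : ℝ) : ℂ) * psi k n x :=
  MemLp.coeFn_toLp _

lemma inner_psiLp (k n : ℤ) (f : Lp ℂ 2 (wMeasure k)) :
    inner ℂ (psiLp k n) f = (((Real.sqrt Real.pi)⁻¹ : ℝ) : ℂ) *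
      ∫ x, cayley x ^ (-n) * (((x : ℂ) + Complex.I) ^ (k + 1) * f x) ∂wMeasure (-1) := by
  rw [integral_wMeasure, L2.inner_def]
  simp only [← weight_smul_conj_psi_mul]
  rw [← integral_wMeasure, ← integral_const_mul]
  refine integral_congr_ae ?_
  filter_upwards [coeFn_psiLp k n] with x hx
  rw [hx, RCLike.inner_apply, map_mul, Complex.conj_ofReal]
  ring

lemma orthonormal_psiLp (k : ℤ) : Orthonormal ℂ (psiLp k) := by
  rw [orthonormal_iff_ite]
  intro n m
  have hae : (fun x => cayley x ^ (-n) * (((x : ℂ) + Complex.I) ^ (k + 1) * psiLp k m x))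
      =ᵐ[wMeasure (-1)]
      fun x => (((Real.sqrt Real.pi)⁻¹ : ℝ) : ℂ) * cayley x ^ (m - n) := by
    have h := coeFn_psiLp k m
    rw [Filter.EventuallyEq, ae_wMeasure, ← ae_wMeasure (-1)] at h
    filter_upwards [h] with x hx
    rw [hx, sub_eq_add_neg, zpow_add₀ (cayley_ne_zero x), ← psi_mul_zpow k m]
    ring
  rw [inner_psiLp, integral_congr_ae hae, integral_const_mul, integral_cayley_zpow_wMeasure]
  have hpi : (((Real.sqrt Real.pi)⁻¹ : ℝ) : ℂ) * ((((Real.sqrt Real.pi)⁻¹ : ℝ) : ℂ) *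
      (Real.pi : ℂ)) = 1 := by
    rw [← Complex.ofReal_mul, ← Complex.ofReal_mul, ← mul_assoc, ← mul_inv,
      Real.mul_self_sqrt Real.pi_pos.le, inv_mul_cancel₀ Real.pi_ne_zero, Complex.ofReal_one]
  by_cases hnm : n = m
  · subst hnm
    simpa using hpi
  · simp [hnm, sub_eq_zero, Ne.symm hnm]

lemma orthogonal_span_psiLp (k : ℤ) :
    (Submodule.span ℂ (Set.range (psiLp k)))ᗮ = ⊥ := by
  refine (Submodule.eq_bot_iff _).2 fun f hf => ?_
  have hinner (n : ℤ) : inner ℂ (psiLp k n) f = 0 :=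
    (Submodule.mem_orthogonal _ _).1 hf _ (Submodule.subset_span ⟨n, rfl⟩)
  have hzero := ae_eq_zero_of_integral_cayley_zpow_mul (memLp_zpow_mul (Lp.memLp f)) fun n => by
    have h := hinner (-n)
    rw [inner_psiLp, neg_neg] at h
    refine (mul_eq_zero.1 h).resolve_left ?_
    exact_mod_cast inv_ne_zero (Real.sqrt_ne_zero'.2 Real.pi_pos)
  rw [Lp.eq_zero_iff_ae_eq_zero]
  rw [Filter.EventuallyEq, ae_wMeasure, ← ae_wMeasure k] at hzero
  filter_upwards [hzero] with x hx
  exact (mul_eq_zero.1 hx).resolve_left (zpow_ne_zero _ (ofReal_add_I_ne_zero x))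

end CayleyBasis

/-- For every integer `k`, the family `{π^{-1/2} ψ_{k,n} : n ∈ ℤ}` is a
Hilbert (complete orthonormal) basis of `L²_{(k)}(ℝ)`, the `L²` space of the measure
`(x² + 1)^k dx` on `ℝ`. -/
theorem stmt6 (k : ℤ) :
    ∃ b : HilbertBasis ℤ ℂ (Lp ℂ 2 (wMeasure k)),
      ∀ n : ℤ, (⇑(b n) : ℝ → ℂ) =ᵐ[wMeasure k]
        fun x => (((Real.sqrt Real.pi)⁻¹ : ℝ) : ℂ) * psi k n x := by
  refine ⟨HilbertBasis.mkOfOrthogonalEqBot (CayleyBasis.orthonormal_psiLp k)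
    (CayleyBasis.orthogonal_span_psiLp k), fun n => ?_⟩
  rw [HilbertBasis.coe_mkOfOrthogonalEqBot]
  exact CayleyBasis.coeFn_psiLp k n
end

section
/- For every natural number n, the L²-Fourier transform (Fourier–Plancherel transform) of ψ_{0,n}, with the convention (ℱ f)(y) = (2π)^{-1/2} ∫_ℝ f(x) e^{−iyx} dx, equals almost everywhere the function y ↦ −i · √(2π) · e^{−y} · L_n(2y) for y ≥ 0 and 0 for y < 0, where L_n is the n-th Laguerre polynomial. -/
open MeasureTheory

/-- The `n`-th Laguerre polynomial `L_n(t) = Σ_{j=0}^{n} C(n,j) (-t)^j / j!`. -/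
noncomputable def laguerre (n : ℕ) (t : ℝ) : ℝ :=
  ∑ j ∈ Finset.range (n + 1), (n.choose j : ℝ) * (-t) ^ j / (j.factorial : ℝ)

open FourierTransform Filter Topology
open scoped SchwartzMap

theorem integral_fourier_mul_eq {f g : ℝ → ℂ} (hf : Integrable f) (hg : Integrable g) :
    ∫ ξ, 𝓕 f ξ * g ξ = ∫ x, f x * 𝓕 g x := by
  simpa using! VectorFourier.integral_fourierIntegral_smul_eq_flip (L := innerₗ ℝ)
      Real.continuous_fourierChar continuous_inner hf hg

theorem continuous_fourier_of_integrable {f : ℝ → ℂ} (hf : Integrable f) : Continuous (𝓕 f) :=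
  VectorFourier.fourierIntegral_continuous Real.continuous_fourierChar continuous_inner hf

theorem fourierInv_eq_comp_neg (f : ℝ → ℂ) : 𝓕⁻ f = fun x => 𝓕 f (-x) :=
  funext fun x => Real.fourierInv_eq_fourier_neg f x

theorem continuous_fourierInv_of_integrable {f : ℝ → ℂ} (hf : Integrable f) :
    Continuous (𝓕⁻ f) := by
  rw [fourierInv_eq_comp_neg]
  exact (continuous_fourier_of_integrable hf).comp continuous_neg

theorem integral_fourierInv_mul_eq {f g : ℝ → ℂ} (hf : Integrable f) (hg : Integrable g) :
    ∫ ξ, 𝓕⁻ f ξ * g ξ = ∫ x, f x * 𝓕⁻ g x := by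
  rw [Real.fourierInv_eq_fourier_comp_neg, fourierInv_eq_comp_neg g,
    integral_fourier_mul_eq hf.comp_neg hg,
    ← integral_neg_eq_self]
  simp

theorem ae_eq_of_integral_schwartz_mul_eq {u v : ℝ → ℂ} (hu : LocallyIntegrable u)
    (hv : LocallyIntegrable v) (h : ∀ φ : 𝓢(ℝ, ℂ), ∫ x, φ x * u x = ∫ x, φ x * v x) :
    u =ᵐ[volume] v := by
  refine ae_eq_of_integral_contDiff_smul_eq hu hv fun g hg hc => ?_
  simpa only [Complex.real_smul] using!
    h (HasCompactSupport.toSchwartzMap (f := fun x => (g x : ℂ))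
      (hc.comp_left Complex.ofReal_zero) (Complex.ofRealCLM.contDiff.comp hg))

theorem fourier_toLp_ae_eq {f : ℝ → ℂ} (hf : Integrable f) (hf2 : MemLp f 2) :
    ((𝓕 (hf2.toLp f) : Lp ℂ 2 (volume : Measure ℝ)) : ℝ → ℂ) =ᵐ[volume] 𝓕 f := by
  refine ae_eq_of_integral_schwartz_mul_eq
    ((Lp.memLp (𝓕 (hf2.toLp f))).locallyIntegrable (by norm_num))
    (continuous_fourier_of_integrable hf).locallyIntegrable fun φ => ?_
  have key := congrArg (fun T => T φ) (Lp.fourier_toTemperedDistribution_eq (hf2.toLp f))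
  simp only [TemperedDistribution.fourier_apply, Lp.toTemperedDistribution_apply,
    SchwartzMap.fourier_coe, smul_eq_mul] at key
  rw [← key, ← integral_fourier_mul_eq φ.integrable hf]
  refine integral_congr_ae ?_
  filter_upwards [hf2.coeFn_toLp] with x hx
  rw [hx]

theorem fourierInv_toLp_ae_eq {f : ℝ → ℂ} (hf : Integrable f) (hf2 : MemLp f 2) :
    ((𝓕⁻ (hf2.toLp f) : Lp ℂ 2 (volume : Measure ℝ)) : ℝ → ℂ) =ᵐ[volume] 𝓕⁻ f := by
  refine ae_eq_of_integral_schwartz_mul_eq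
    ((Lp.memLp (𝓕⁻ (hf2.toLp f))).locallyIntegrable (by norm_num))
    (continuous_fourierInv_of_integrable hf).locallyIntegrable fun φ => ?_
  have key := congrArg (fun T => T φ) (Lp.fourierInv_toTemperedDistribution_eq (hf2.toLp f))
  simp only [TemperedDistribution.fourierInv_apply, Lp.toTemperedDistribution_apply,
    SchwartzMap.fourierInv_coe, smul_eq_mul] at key
  rw [← key, ← integral_fourierInv_mul_eq φ.integrable hf]
  refine integral_congr_ae ?_
  filter_upwards [hf2.coeFn_toLp] with x hx
  rw [hx]

theorem integral_norm_sq_eq_norm_sq (u : Lp ℂ 2 (volume : Measure ℝ)) :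
    ∫ x, ‖u x‖ ^ 2 = ‖u‖ ^ 2 := by
  have h := inner_self_eq_norm_sq_to_K (𝕜 := ℂ) u
  rw [L2.inner_def] at h
  simp only [inner_self_eq_norm_sq_to_K] at h
  exact_mod_cast h

theorem tendsto_integral_norm_sq_fourier_truncation_sub {h : ℝ → ℂ} (hi : Integrable h)
    (h2 : MemLp h 2) :
    Tendsto (fun R : ℝ => ∫ w, ‖𝓕 ((Set.Ioc (-R) R).indicator (𝓕⁻ h)) w - h w‖ ^ 2)
      atTop (𝓝 0) := by
  have hae := fourierInv_toLp_ae_eq hi h2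
  have hψ2 : MemLp (𝓕⁻ h) 2 := (memLp_congr_ae hae).1 (Lp.memLp _)
  have key (R : ℝ) : ∫ w, ‖𝓕 ((Set.Ioc (-R) R).indicator (𝓕⁻ h)) w - h w‖ ^ 2 =
      ∫ x, ‖(Set.Ioc (-R) R).indicator (𝓕⁻ h) x - 𝓕⁻ h x‖ ^ 2 := by
    have hR2 : MemLp ((Set.Ioc (-R) R).indicator (𝓕⁻ h)) 2 := hψ2.indicator measurableSet_Ioc
    have hR1 : Integrable ((Set.Ioc (-R) R).indicator (𝓕⁻ h)) :=
      (integrable_indicator_iff measurableSet_Ioc).2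
        ((continuous_fourierInv_of_integrable hi).integrableOn_Icc.mono_set Set.Ioc_subset_Icc_self)
    have hdist := (Lp.fourierTransformₗᵢ ℝ ℂ).dist_map (hR2.toLp _) (𝓕⁻ (h2.toLp h))
    change dist (𝓕 (hR2.toLp _)) (𝓕 (𝓕⁻ (h2.toLp h))) = _ at hdist
    rw [fourier_fourierInv_eq, dist_eq_norm, dist_eq_norm] at hdist
    have hsq := congrArg (· ^ 2) hdist
    simp only [← integral_norm_sq_eq_norm_sq] at hsq
    convert! hsq using 1 <;> refine integral_congr_ae ?_
    · filter_upwards [Lp.coeFn_sub (𝓕 (hR2.toLp _)) (h2.toLp h), fourier_toLp_ae_eq hR1 hR2,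
        h2.coeFn_toLp] with x h1 h2 h3
      rw [h1, Pi.sub_apply, h2, h3]
    · filter_upwards [Lp.coeFn_sub (hR2.toLp _) (𝓕⁻ (h2.toLp h)), hR2.coeFn_toLp, hae]
        with x h1 h2 h3
      rw [h1, Pi.sub_apply, h2, h3]
  simp only [key]
  rw [← integral_zero ℝ ℝ]
  refine tendsto_integral_filter_of_dominated_convergence (fun x => ‖𝓕⁻ h x‖ ^ 2) ?_ ?_
    ((memLp_two_iff_integrable_sq_norm hψ2.1).1 hψ2) ?_
  · refine .of_forall fun R => ?_
    exact ((hψ2.1.indicator measurableSet_Ioc).sub hψ2.1).norm.pow 2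
  · refine .of_forall fun R => .of_forall fun x => ?_
    by_cases hx : x ∈ Set.Ioc (-R) R <;> simp [hx]
  · refine .of_forall fun x => ?_
    refine tendsto_const_nhds.congr' ?_
    filter_upwards [eventually_gt_atTop |x|] with R hR
    have := abs_lt.1 hR
    simp [Set.indicator_of_mem (show x ∈ Set.Ioc (-R) R from ⟨this.1, this.2.le⟩)]

theorem integrableOn_pow_mul_exp_neg (n : ℕ) {s : ℂ} (hs : 0 < s.re) :
    IntegrableOn (fun t : ℝ => (t : ℂ) ^ n * Complex.exp (-s * t)) (Set.Ioi 0) := by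
  have h := integrableOn_rpow_mul_exp_neg_mul_rpow (s := n) (p := 1) (b := s.re)
    (by linarith [n.cast_nonneg (α := ℝ)]) one_pos hs
  refine h.mono' (by fun_prop) ?_
  filter_upwards [ae_restrict_mem measurableSet_Ioi] with t ht
  simp [Complex.norm_exp, abs_of_pos (Set.mem_Ioi.1 ht)]

theorem integral_pow_mul_exp_neg (n : ℕ) {s : ℂ} (hs : 0 < s.re) :
    ∫ t : ℝ in Set.Ioi 0, (t : ℂ) ^ n * Complex.exp (-s * t) = n.factorial / s ^ (n + 1) := by
  have hs0 : s ≠ 0 := by rintro rfl; simp at hs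
  have hlim (n : ℕ) : Tendsto (fun t : ℝ => (t : ℂ) ^ n * Complex.exp (-s * t)) atTop (𝓝 0) := by
    rw [tendsto_zero_iff_norm_tendsto_zero]
    have := tendsto_rpow_mul_exp_neg_mul_atTop_nhds_zero n s.re hs
    refine this.congr' ?_
    filter_upwards [eventually_gt_atTop 0] with t ht
    simp [Complex.norm_exp, abs_of_pos ht]
  have hexp (t : ℝ) :
      HasDerivAt (fun t : ℝ => Complex.exp (-s * t)) (-s * Complex.exp (-s * t)) t := by
    have := ((Complex.ofRealCLM.hasDerivAt (x := t)).const_mul (-s)).cexp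
    simpa [mul_comm] using this
  induction n with
  | zero =>
    have := integral_Ioi_of_hasDerivAt_of_tendsto' (a := 0) (fun t _ => hexp t)
      (by simpa [IntegrableOn] using (integrableOn_pow_mul_exp_neg 0 hs).const_mul (-s))
      (by simpa using hlim 0)
    rw [integral_const_mul] at this
    simp at this
    simp
    field_simp
    linear_combination this
  | succ n ih =>
    have hd (t : ℝ) : HasDerivAt (fun t : ℝ => (t : ℂ) ^ (n + 1) * Complex.exp (-s * t))
        ((n + 1) * ((t : ℂ) ^ n * Complex.exp (-s * t)) -
          s * ((t : ℂ) ^ (n + 1) * Complex.exp (-s * t))) t := by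
      have := ((Complex.ofRealCLM.hasDerivAt (x := t)).pow (n + 1)).mul (hexp t)
      convert! this using 1
      simp
      ring
    have h1 := (integrableOn_pow_mul_exp_neg n hs).const_mul (n + 1 : ℂ)
    have h2 := (integrableOn_pow_mul_exp_neg (n + 1) hs).const_mul s
    have := integral_Ioi_of_hasDerivAt_of_tendsto' (a := 0) (fun t _ => hd t) (h1.sub h2) (hlim _)
    rw [integral_sub h1 h2, integral_const_mul, integral_const_mul, ih] at this
    simp at this
    rw [eq_div_iff (pow_ne_zero _ hs0)]
    field_simp at this
    push_cast [Nat.factorial_succ, neg_mul]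
    linear_combination -this

/-- The function `y ↦ -i e^{-y} L_n(2y)` on `[0, ∞)`, extended by zero. -/
noncomputable def laguerreExp (n : ℕ) (y : ℝ) : ℂ :=
  if 0 ≤ y then -Complex.I * (Real.exp (-y) : ℝ) * (laguerre n (2 * y) : ℝ) else 0

theorem laguerreExp_eq_indicator (n : ℕ) :
    laguerreExp n = (Set.Ici 0).indicator fun y : ℝ => ∑ j ∈ Finset.range (n + 1),
      (-Complex.I * (n.choose j * (-2) ^ j / j.factorial)) *
        ((y : ℂ) ^ j * Complex.exp (-1 * y)) := by
  ext y
  by_cases hy : 0 ≤ y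
  · rw [Set.indicator_of_mem (Set.mem_Ici.2 hy), laguerreExp, if_pos hy, laguerre]
    push_cast
    rw [Finset.mul_sum]
    refine Finset.sum_congr rfl fun j _ => ?_
    rw [← neg_mul, mul_pow]
    ring_nf
  · rw [Set.indicator_of_notMem (by simpa using hy), laguerreExp, if_neg hy]

theorem integrable_laguerreExp (n : ℕ) : Integrable (laguerreExp n) := by
  rw [laguerreExp_eq_indicator, integrable_indicator_iff measurableSet_Ici,
    integrableOn_Ici_iff_integrableOn_Ioi]
  exact integrable_finsetSum _ fun j _ => (integrableOn_pow_mul_exp_neg j (by simp)).const_mul _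

theorem memLp_two_laguerreExp (n : ℕ) : MemLp (laguerreExp n) 2 := by
  rw [laguerreExp_eq_indicator, memLp_indicator_iff_restrict measurableSet_Ici,
    ← Measure.restrict_congr_set Ioi_ae_eq_Ici]
  refine memLp_finsetSum _ fun j _ => MemLp.const_mul ?_ _
  rw [memLp_two_iff_integrable_sq_norm (by fun_prop)]
  refine (integrableOn_pow_mul_exp_neg (2 * j) (s := 2) (by simp)).norm.congr ?_
  refine .of_forall fun t => ?_
  simp [Complex.norm_exp, mul_pow, ← pow_mul, ← Real.exp_nat_mul, mul_comm]

theorem integral_exp_mul_laguerreExp (n : ℕ) (x : ℝ) :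
    ∫ y : ℝ, Complex.exp (Complex.I * y * x) * laguerreExp n y = psi 0 n x := by
  set s : ℂ := 1 - Complex.I * x with hs
  have hre : 0 < s.re := by simp [hs]
  have hs0 : s ≠ 0 := by intro h; simp [h] at hre
  have hadd : (x : ℂ) + Complex.I = Complex.I * s := by
    linear_combination (x : ℂ) * Complex.I_sq
  have hsub : (x : ℂ) - Complex.I = Complex.I * (s - 2) := by
    linear_combination (x : ℂ) * Complex.I_sq
  calc ∫ y : ℝ, Complex.exp (Complex.I * y * x) * laguerreExp n y
      = ∫ y : ℝ in Set.Ioi 0, ∑ j ∈ Finset.range (n + 1),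
          (-Complex.I * (n.choose j * (-2) ^ j / j.factorial)) *
            ((y : ℂ) ^ j * Complex.exp (-s * y)) := by
        rw [← integral_Ici_eq_integral_Ioi, ← integral_indicator measurableSet_Ici,
          laguerreExp_eq_indicator]
        congr 1 with y
        by_cases hy : y ∈ Set.Ici 0
        · simp only [Set.indicator_of_mem hy, Finset.mul_sum]
          refine Finset.sum_congr rfl fun j _ => ?_
          rw [show -s * (y : ℂ) = Complex.I * y * x + -1 * y by rw [hs]; ring, Complex.exp_add]
          ring
        · simp only [Set.indicator_of_notMem hy, mul_zero]
    _ = ∑ j ∈ Finset.range (n + 1), (-Complex.I * (n.choose j * (-2) ^ j / j.factorial)) *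
          (j.factorial / s ^ (j + 1)) := by
        rw [integral_finsetSum _ fun j _ => (integrableOn_pow_mul_exp_neg j hre).const_mul _]
        simp only [integral_const_mul, integral_pow_mul_exp_neg _ hre]
    _ = -Complex.I / s * (-2 / s + 1) ^ n := by
        rw [add_pow, Finset.mul_sum]
        refine Finset.sum_congr rfl fun j _ => ?_
        have : (j.factorial : ℂ) ≠ 0 := by exact_mod_cast j.factorial_ne_zero
        rw [div_pow]
        field_simp
        rw [one_pow, mul_one, pow_succ]
        ring
    _ = psi 0 n x := by
        rw [psi, hadd, hsub, mul_div_mul_left _ _ Complex.I_ne_zero, zero_add, zpow_neg_one,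
          zpow_natCast, mul_inv, Complex.inv_I]
        congr 1
        field_simp
        ring

theorem fourierInv_laguerreExp_comp_mul (n : ℕ) :
    𝓕⁻ (fun w : ℝ => (2 * Real.pi : ℂ) * laguerreExp n (2 * Real.pi * w)) = psi 0 n := by
  ext x
  rw [Real.fourierInv_eq', ← integral_exp_mul_laguerreExp]
  have h := Measure.integral_comp_mul_left
    (fun y : ℝ => (2 * Real.pi : ℂ) * (Complex.exp (Complex.I * y * x) * laguerreExp n y))
    (2 * Real.pi)
  rw [integral_const_mul, integral_const_mul, abs_of_pos (by positivity),
    Complex.real_smul] at h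
  push_cast at h
  rw [inv_mul_cancel_left₀ (by simp [Real.pi_ne_zero])] at h
  rw [← h, ← integral_const_mul]
  congr 1 with w
  simp only [smul_eq_mul, RCLike.inner_apply, conj_trivial]
  push_cast
  ring_nf

theorem fourier_indicator_Ioc (f : ℝ → ℂ) {R : ℝ} (hR : 0 ≤ R) (w : ℝ) :
    𝓕 ((Set.Ioc (-R) R).indicator f) w =
      ∫ x in (-R)..R, f x * Complex.exp (-(Complex.I * (2 * Real.pi * w) * x)) := by
  rw [Real.fourier_eq', intervalIntegral.integral_of_le (by linarith),
    ← integral_indicator measurableSet_Ioc]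
  congr 1 with x
  by_cases hx : x ∈ Set.Ioc (-R) R
  · simp only [Set.indicator_of_mem hx, smul_eq_mul, RCLike.inner_apply, conj_trivial]
    push_cast
    ring_nf
  · simp only [Set.indicator_of_notMem hx, smul_zero]

/-- For every `n ∈ ℕ`, the `L²` (Fourier–Plancherel) transform of
`ψ_{0,n}`, with the convention `(ℱ f)(y) = (2π)^{-1/2} ∫ f(x) e^{-iyx} dx`, equals
almost everywhere `y ↦ -i √(2π) e^{-y} L_n(2y)` for `y ≥ 0` and `0` for `y < 0`.
Since `ψ_{0,n}` is square-integrable but not integrable, the transform is taken in the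
Plancherel sense: the truncated transforms `y ↦ (2π)^{-1/2} ∫_{-R}^{R} ψ_{0,n}(x) e^{-iyx} dx`
converge in `L²(ℝ)` (as `R → ∞`) to that function. -/
theorem stmt19 (n : ℕ) :
    Filter.Tendsto
      (fun R : ℝ => ∫ y : ℝ,
        ‖(((Real.sqrt (2 * Real.pi))⁻¹ : ℝ) : ℂ) *
            (∫ x in (-R)..R, psi 0 (n : ℤ) x * Complex.exp (-(Complex.I * (y : ℂ) * (x : ℂ)))) -
          (if 0 ≤ y then
              (-Complex.I) * ((Real.sqrt (2 * Real.pi) : ℝ) : ℂ) *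
                ((Real.exp (-y) : ℝ) : ℂ) * ((laguerre n (2 * y) : ℝ) : ℂ)
            else 0)‖ ^ 2)
      Filter.atTop (nhds 0) := by
  have hpi : (2 * Real.pi) ≠ 0 := by positivity
  have hi : Integrable fun w : ℝ => (2 * Real.pi : ℂ) * laguerreExp n (2 * Real.pi * w) :=
    ((integrable_laguerreExp n).comp_mul_left' hpi).const_mul _
  have h2 : MemLp (fun w : ℝ => (2 * Real.pi : ℂ) * laguerreExp n (2 * Real.pi * w)) 2 := by
    refine MemLp.const_mul ?_ _
    have hsm := (integrable_laguerreExp n).comp_mul_left' hpi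
    rw [memLp_two_iff_integrable_sq_norm hsm.1]
    exact ((memLp_two_iff_integrable_sq_norm (memLp_two_laguerreExp n).1).1
      (memLp_two_laguerreExp n)).comp_mul_left' hpi
  have key := tendsto_integral_norm_sq_fourier_truncation_sub hi h2
  rw [fourierInv_laguerreExp_comp_mul] at key
  refine key.congr' ?_
  filter_upwards [eventually_ge_atTop 0] with R hR
  simp only [fourier_indicator_Ioc _ hR]
  have hsq : ((Real.sqrt (2 * Real.pi) : ℝ) : ℂ) ^ 2 = 2 * Real.pi := by
    exact_mod_cast Real.sq_sqrt (by positivity)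
  have hsq0 : ((Real.sqrt (2 * Real.pi) : ℝ) : ℂ) ≠ 0 := by
    exact_mod_cast (Real.sqrt_pos.2 (by positivity)).ne'
  have hcomp := Measure.integral_comp_div (fun w : ℝ =>
    ‖(∫ x in (-R)..R, psi 0 n x * Complex.exp (-(Complex.I * (2 * Real.pi * w) * x))) -
      (2 * Real.pi : ℂ) * laguerreExp n (2 * Real.pi * w)‖ ^ 2) (2 * Real.pi)
  rw [smul_eq_mul, abs_of_pos (by positivity), ← inv_mul_eq_iff_eq_mul₀ hpi,
    ← integral_const_mul] at hcomp
  rw [← hcomp]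
  congr 1 with y
  have hy : (2 * Real.pi : ℂ) * ((y / (2 * Real.pi) : ℝ) : ℂ) = y := by
    exact_mod_cast mul_div_cancel₀ y hpi
  rw [hy, mul_div_cancel₀ y hpi]
  have hif : (if 0 ≤ y then (-Complex.I) * ((Real.sqrt (2 * Real.pi) : ℝ) : ℂ) *
      ((Real.exp (-y) : ℝ) : ℂ) * ((laguerre n (2 * y) : ℝ) : ℂ) else 0) =
      ((Real.sqrt (2 * Real.pi) : ℝ) : ℂ) * laguerreExp n y := by
    rw [laguerreExp]
    split_ifs <;> ring
  rw [hif, ← hsq, show (((Real.sqrt (2 * Real.pi))⁻¹ : ℝ) : ℂ) *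
      (∫ x in (-R)..R, psi 0 (n : ℤ) x * Complex.exp (-(Complex.I * (y : ℂ) * (x : ℂ)))) -
      ((Real.sqrt (2 * Real.pi) : ℝ) : ℂ) * laguerreExp n y =
      (((Real.sqrt (2 * Real.pi))⁻¹ : ℝ) : ℂ) * ((∫ x in (-R)..R, psi 0 (n : ℤ) x *
        Complex.exp (-(Complex.I * (y : ℂ) * (x : ℂ)))) -
      ((Real.sqrt (2 * Real.pi) : ℝ) : ℂ) ^ 2 * laguerreExp n y) by
    push_cast
    field_simp]
  rw [norm_mul, mul_pow, Complex.norm_real, Real.norm_eq_abs, sq_abs, inv_pow,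
    Real.sq_sqrt (by positivity)]
end
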